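/- Set L̂ = MD. For every k ≥ 1 the quantum Wick formula holds in Mat_{N^{k+1}}(A): (M_{⟨1→k⟩} D_{⟨k→1⟩} ∏_{s=1}^{k} J_s⁻¹) · L̂_{⟨k+1⟩} = M_{⟨1→(k+1)⟩} D_{⟨(k+1)→1⟩} ∏_{s=1}^{k+1} J_s⁻¹ + (M_{⟨1→k⟩} D_{⟨k→1⟩} ∏_{s=1}^{k} J_s⁻¹) · (I − J_{k+1}⁻¹)/(q − q⁻¹). (Here M_{⟨1→k⟩} D_{⟨k→1⟩} ∏_{s=1}^{k} J_s⁻¹ is the normally ordered monomial :L̂_{⟨1→k⟩}:, so the formula reads :L̂_{⟨1→k⟩}: L̂_{⟨k+1⟩} = :L̂_{⟨1→(k+1)⟩}: + :L̂_{⟨1→k⟩}: (I − J_{k+1}⁻¹)/(q − q⁻¹).) -/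

import Mathlib

open scoped BigOperators

noncomputable section

/-- One-site embedding of an `N×N` matrix into `Mat_{N^k}` at 0-based position `i`
(the paper's `X_{i+1}` in 1-based numbering).  Out of range we return the identity. -/
def matAt {α : Type*} [Semiring α] (N k : ℕ) (X : Matrix (Fin N) (Fin N) α) (i : ℕ) :
    Matrix (Fin k → Fin N) (Fin k → Fin N) α :=
  if h : i < k then
    Matrix.of fun a b =>
      if ∀ l : Fin k, (l : ℕ) ≠ i → a l = b l then X (a ⟨i, h⟩) (b ⟨i, h⟩) else 0
  else 1

/-- Two-site embedding of an operator on `V⊗V` into `Mat_{N^k}` at 0-based positions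
`i, i+1` (the paper's `R_{i+1}` in 1-based numbering). -/
def opAt {α : Type*} [Semiring α] (N k : ℕ)
    (R : Matrix (Fin N × Fin N) (Fin N × Fin N) α) (i : ℕ) :
    Matrix (Fin k → Fin N) (Fin k → Fin N) α :=
  if h : i + 1 < k then
    Matrix.of fun a b =>
      if ∀ l : Fin k, (l : ℕ) ≠ i → (l : ℕ) ≠ i + 1 → a l = b l then
        R (a ⟨i, by omega⟩, a ⟨i + 1, h⟩) (b ⟨i, by omega⟩, b ⟨i + 1, h⟩)
      else 0
  else 1

/-- A numeric (complex) matrix viewed inside `Mat(A)` via the unit of `A`. -/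
def toA (A : Type*) [Semiring A] [Algebra ℂ A] {ι : Type*} (X : Matrix ι ι ℂ) :
    Matrix ι ι A :=
  X.map (algebraMap ℂ A)

/-- The braid relation `R₁R₂R₁ = R₂R₁R₂` on `V^{⊗3}`. -/
def IsBraid (N : ℕ) (R : Matrix (Fin N × Fin N) (Fin N × Fin N) ℂ) : Prop :=
  opAt N 3 R 0 * opAt N 3 R 1 * opAt N 3 R 0 = opAt N 3 R 1 * opAt N 3 R 0 * opAt N 3 R 1

/-- The Hecke condition `(q·I − R)(q⁻¹·I + R) = 0`. -/
def IsHecke (N : ℕ) (q : ℂ) (R : Matrix (Fin N × Fin N) (Fin N × Fin N) ℂ) : Prop :=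
  (q • (1 : Matrix (Fin N × Fin N) (Fin N × Fin N) ℂ) - R) * (q⁻¹ • 1 + R) = 0

/-- `q` is generic: `q ∉ {0, 1, −1}` and `qⁿ ≠ 1` for all positive integers `n`. -/
def GenericQ (q : ℂ) : Prop :=
  q ≠ 0 ∧ q ≠ 1 ∧ q ≠ -1 ∧ ∀ n : ℕ, 0 < n → q ^ n ≠ 1

/-- The reflection-equation type relation `R X₁ R X₁ = X₁ R X₁ R` in `Mat_{N²}`. -/
def RErel {α : Type*} [Semiring α] (N : ℕ)
    (R : Matrix (Fin N × Fin N) (Fin N × Fin N) α) (X : Matrix (Fin N) (Fin N) α) : Prop :=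
  opAt N 2 R 0 * matAt N 2 X 0 * opAt N 2 R 0 * matAt N 2 X 0 =
    matAt N 2 X 0 * opAt N 2 R 0 * matAt N 2 X 0 * opAt N 2 R 0

/-- The quantum-double permutation relation `D₁ R M₁ R = R M₁ R⁻¹ D₁ + R` in `Mat_{N²}(A)`. -/
def PermRel {A : Type*} [Ring A] [Algebra ℂ A] (N : ℕ)
    (R Rinv : Matrix (Fin N × Fin N) (Fin N × Fin N) ℂ)
    (M D : Matrix (Fin N) (Fin N) A) : Prop :=
  matAt N 2 D 0 * opAt N 2 (toA A R) 0 * matAt N 2 M 0 * opAt N 2 (toA A R) 0 =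
    opAt N 2 (toA A R) 0 * matAt N 2 M 0 * opAt N 2 (toA A Rinv) 0 * matAt N 2 D 0 +
      opAt N 2 (toA A R) 0

/-- The homogeneous permutation relation `D₁ R M₁ R = R M₁ R⁻¹ D₁` in `Mat_{N²}(A)`. -/
def PermRelHom {A : Type*} [Ring A] [Algebra ℂ A] (N : ℕ)
    (R Rinv : Matrix (Fin N × Fin N) (Fin N × Fin N) ℂ)
    (M D : Matrix (Fin N) (Fin N) A) : Prop :=
  matAt N 2 D 0 * opAt N 2 (toA A R) 0 * matAt N 2 M 0 * opAt N 2 (toA A R) 0 =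
    opAt N 2 (toA A R) 0 * matAt N 2 M 0 * opAt N 2 (toA A Rinv) 0 * matAt N 2 D 0

/-- Overline copies: `ovCopy … r = X_{⟨r+1⟩}`, i.e. `X_{⟨1⟩} = X⊗I⊗⋯⊗I` and
`X_{⟨r+1⟩} = R_r X_{⟨r⟩} R_r⁻¹`. -/
def ovCopy {α : Type*} [Semiring α] (N k : ℕ)
    (R Rinv : Matrix (Fin N × Fin N) (Fin N × Fin N) α)
    (X : Matrix (Fin N) (Fin N) α) : ℕ → Matrix (Fin k → Fin N) (Fin k → Fin N) α
  | 0 => matAt N k X 0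
  | r + 1 => opAt N k R r * ovCopy N k R Rinv X r * opAt N k Rinv r

/-- Underline copies: `unCopy … r = X_{[r+1]}`, i.e. `X_{[1]} = X⊗I⊗⋯⊗I` and
`X_{[r+1]} = R_r⁻¹ X_{[r]} R_r`. -/
def unCopy {α : Type*} [Semiring α] (N k : ℕ)
    (R Rinv : Matrix (Fin N × Fin N) (Fin N × Fin N) α)
    (X : Matrix (Fin N) (Fin N) α) : ℕ → Matrix (Fin k → Fin N) (Fin k → Fin N) α
  | 0 => matAt N k X 0
  | r + 1 => opAt N k Rinv r * unCopy N k R Rinv X r * opAt N k R r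

/-- `X_{⟨1→n⟩} = X_{⟨1⟩}X_{⟨2⟩}⋯X_{⟨n⟩}`. -/
def ovProd {α : Type*} [Semiring α] (N k : ℕ)
    (R Rinv : Matrix (Fin N × Fin N) (Fin N × Fin N) α)
    (X : Matrix (Fin N) (Fin N) α) (n : ℕ) : Matrix (Fin k → Fin N) (Fin k → Fin N) α :=
  ((List.range n).map (ovCopy N k R Rinv X)).prod

/-- `X_{⟨n→1⟩} = X_{⟨n⟩}X_{⟨n−1⟩}⋯X_{⟨1⟩}`. -/
def ovProdRev {α : Type*} [Semiring α] (N k : ℕ)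
    (R Rinv : Matrix (Fin N × Fin N) (Fin N × Fin N) α)
    (X : Matrix (Fin N) (Fin N) α) (n : ℕ) : Matrix (Fin k → Fin N) (Fin k → Fin N) α :=
  ((List.range n).reverse.map (ovCopy N k R Rinv X)).prod

/-- Shifted Jucys–Murphy matrices: `JMup … R n s = J_{s+1}^{↑n}`, i.e. `J₁^{↑n} = I` and
`J_{s+1}^{↑n} = R_{n+s} J_s^{↑n} R_{n+s}` (paper's 1-based `R_{n+s}` is `opAt … (n+s-1)`).
Applying it to `R⁻¹` produces `(J_{s+1}^{↑n})⁻¹`. -/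
def JMup {α : Type*} [Semiring α] (N k : ℕ)
    (R : Matrix (Fin N × Fin N) (Fin N × Fin N) α) (n : ℕ) :
    ℕ → Matrix (Fin k → Fin N) (Fin k → Fin N) α
  | 0 => 1
  | s + 1 => opAt N k R (n + s) * JMup N k R n s * opAt N k R (n + s)

/-- The quantum trace `Tr_{R(1…n)}(X) = Tr(C₁C₂⋯C_n X)`. -/
def qTr {α : Type*} [Semiring α] (N n : ℕ) (C : Matrix (Fin N) (Fin N) α)
    (X : Matrix (Fin n → Fin N) (Fin n → Fin N) α) : α :=
  Matrix.trace (((List.range n).map (matAt N n C)).prod * X)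

/-- The matrix `C`, `C_i^j = Σ_k Ψ_{ik}^{jk}`. -/
def traceMat (N : ℕ) (Ψ : Matrix (Fin N × Fin N) (Fin N × Fin N) ℂ) :
    Matrix (Fin N) (Fin N) ℂ :=
  Matrix.of fun i j => ∑ k, Ψ (i, k) (j, k)

/-- Skew-invertibility of `R`: `Tr₂(R₁₂Ψ₂₃) = Tr₂(Ψ₁₂R₂₃) = P₁₃`, written componentwise. -/
def SkewInv (N : ℕ) (R Ψ : Matrix (Fin N × Fin N) (Fin N × Fin N) ℂ) : Prop :=
  (∀ i k l n : Fin N, ∑ j, ∑ b, R (i, j) (l, b) * Ψ (b, k) (j, n) =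
      if i = n ∧ k = l then 1 else 0) ∧
  (∀ i k l n : Fin N, ∑ j, ∑ b, Ψ (i, j) (l, b) * R (b, k) (j, n) =
      if i = n ∧ k = l then 1 else 0)

/-- The generators `R₁, …, R_{n−1}` (1-based) of the Hecke-algebra image inside
`End(V^{⊗k})`, as a subset of `Mat_{N^k}`. -/
def genSet {α : Type*} [Semiring α] (N k n : ℕ)
    (R : Matrix (Fin N × Fin N) (Fin N × Fin N) α) :
    Set (Matrix (Fin k → Fin N) (Fin k → Fin N) α) :=
  {X | ∃ i : ℕ, i + 1 < n ∧ X = opAt N k R i}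

/-- The left ideal of `A` generated by the entries of `D`. -/
def entryIdeal (A : Type*) [Ring A] {N : ℕ} (D : Matrix (Fin N) (Fin N) A) :
    Submodule A A :=
  Submodule.span A {x : A | ∃ i j : Fin N, x = D i j}

/-- The normally ordered monomial `:L̂_{⟨1→k⟩}: = M_{⟨1→k⟩} D_{⟨k→1⟩} ∏_{s=1}^{k} J_s⁻¹`. -/
def normOrd {α : Type*} [Semiring α] (N k : ℕ)
    (R Rinv : Matrix (Fin N × Fin N) (Fin N × Fin N) α)
    (M D : Matrix (Fin N) (Fin N) α) (n : ℕ) :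
    Matrix (Fin k → Fin N) (Fin k → Fin N) α :=
  ovProd N k R Rinv M n * ovProdRev N k R Rinv D n *
    ((List.range n).map (fun s => JMup N k Rinv 0 s)).prod

/-! ### Conjugation copies and Jucys–Murphy elements in a ring -/

section Abstract

variable {B : Type*} [Ring B]

/-- Iterated conjugates `x, r₀ x r₀⁻¹, r₁ r₀ x r₀⁻¹ r₁⁻¹, …`. -/
def conjCopy (r : ℕ → Bˣ) (x : B) : ℕ → B
  | 0 => x
  | j + 1 => r j * conjCopy r x j * ↑(r j)⁻¹

/-- Inverse Jucys–Murphy elements attached to a sequence of units. -/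
def invJM (r : ℕ → Bˣ) : ℕ → B
  | 0 => 1
  | j + 1 => ↑(r j)⁻¹ * invJM r j * ↑(r j)⁻¹

theorem conjCopy_mul (r : ℕ → Bˣ) (x y : B) (j : ℕ) :
    conjCopy r (x * y) j = conjCopy r x j * conjCopy r y j := by
  induction j with
  | zero => rfl
  | succ j ih => simp [conjCopy, ih, mul_assoc]

theorem semiconjBy_conjCopy (r : ℕ → Bˣ) (x : B) (j : ℕ) :
    SemiconjBy (r j : B) (conjCopy r x j) (conjCopy r x (j + 1)) := by
  simp [SemiconjBy, conjCopy, mul_assoc]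

theorem eq_of_semiconjBy_unit {a : Bˣ} {x y y' : B} (h : SemiconjBy (a : B) x y)
    (h' : SemiconjBy (a : B) x y') : y = y' := by
  have : y * a = y' * a := h.eq.symm.trans h'.eq
  simpa using this

variable {r : ℕ → Bˣ} {n : ℕ}

theorem commute_conjCopy_of_lt (hfar : ∀ i j, i + 1 < j → Commute (r i : B) (r j)) {x : B}
    (hx : ∀ i, 0 < i → Commute x (r i)) {j i : ℕ} (hij : j < i) :
    Commute (conjCopy r x j) (r i) := by
  induction j with
  | zero => exact hx i hij
  | succ j ih =>
    exact ((hfar j i hij).mul_left (ih (by omega))).mul_left (hfar j i hij).units_inv_left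

theorem commute_conjCopy_of_succ_lt (hfar : ∀ i j, i + 1 < j → Commute (r i : B) (r j))
    (hbr : ∀ i, i + 1 < n → (r i * r (i + 1) * r i : B) = r (i + 1) * r i * r (i + 1)) {x : B}
    (hx : ∀ i, 0 < i → Commute x (r i)) {j i : ℕ} (hij : i + 1 < j) (hj : j ≤ n) :
    Commute (conjCopy r x j) (r i) := by
  induction j with
  | zero => omega
  | succ j ih =>
    rcases Nat.lt_or_ge (i + 1) j with h | h
    · have hc := (hfar i j h).symm
      exact (hc.mul_left (ih h (by omega))).mul_left hc.units_inv_left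
    · obtain rfl : j = i + 1 := by omega
      have hX : Commute (conjCopy r x i) (r (i + 1)) :=
        commute_conjCopy_of_lt hfar hx (Nat.lt_succ_self i)
      have ha : SemiconjBy ((r (i + 1) * r i : Bˣ) : B) (r (i + 1)) (r i) := by
        simp only [SemiconjBy, Units.val_mul, ← mul_assoc]
        exact (hbr i (by omega)).symm
      have hc : SemiconjBy ((r (i + 1) * r i : Bˣ) : B) (conjCopy r x i)
          (conjCopy r x (i + 1 + 1)) := by
        rw [Units.val_mul]
        exact (semiconjBy_conjCopy r x (i + 1)).mul_left (semiconjBy_conjCopy r x i)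
      refine eq_of_semiconjBy_unit (hc.mul_right ha) ?_
      rw [hX.eq]
      exact ha.mul_right hc

theorem commute_invJM_of_le (hfar : ∀ i j, i + 1 < j → Commute (r i : B) (r j)) {j i : ℕ}
    (hij : j < i) : Commute (invJM r j) (r i) := by
  induction j with
  | zero => exact Commute.one_left _
  | succ j ih =>
    have hc := (hfar j i hij).units_inv_left
    exact (hc.mul_left (ih (by omega))).mul_left hc

theorem commute_invJM_of_succ_lt (hfar : ∀ i j, i + 1 < j → Commute (r i : B) (r j))
    (hbr : ∀ i, i + 1 < n → (r i * r (i + 1) * r i : B) = r (i + 1) * r i * r (i + 1))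
    {j i : ℕ} (hij : i + 1 < j) (hj : j ≤ n) : Commute (invJM r j) (r i) := by
  induction j with
  | zero => omega
  | succ j ih =>
    rcases Nat.lt_or_ge (i + 1) j with h | h
    · have hc := (hfar i j h).symm.units_inv_left
      exact (hc.mul_left (ih h (by omega))).mul_left hc
    · obtain rfl : j = i + 1 := by omega
      have hJ : Commute (invJM r i) (r (i + 1)) := commute_invJM_of_le hfar (Nat.lt_succ_self i)
      have hb := hbr i (by omega)
      have h1 : SemiconjBy ((r i * r (i + 1) : Bˣ) : B) (r i) (r (i + 1)) := by
        simp only [SemiconjBy, Units.val_mul, ← mul_assoc]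
        exact hb
      have h2 : SemiconjBy ((r (i + 1) * r i : Bˣ) : B) (r (i + 1)) (r i) := by
        simp only [SemiconjBy, Units.val_mul, ← mul_assoc]
        exact hb.symm
      have h1' := h1.units_inv_symm_left
      have e : invJM r (i + 1 + 1) =
          ((r i * r (i + 1) : Bˣ)⁻¹ : Bˣ) * invJM r i * ((r (i + 1) * r i : Bˣ)⁻¹ : Bˣ) := by
        simp [invJM, mul_assoc]
      have h2' := h2.units_inv_symm_left
      rw [e]
      show SemiconjBy _ _ _
      exact (h1'.mul_left hJ).mul_left h2'

theorem commute_invJM_invJM (hfar : ∀ i j, i + 1 < j → Commute (r i : B) (r j))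
    (hbr : ∀ i, i + 1 < n → (r i * r (i + 1) * r i : B) = r (i + 1) * r i * r (i + 1))
    {j : ℕ} (hj : j ≤ n) {i : ℕ} (hij : i < j) : Commute (invJM r j) (invJM r i) := by
  induction i with
  | zero => exact Commute.one_right _
  | succ i ih =>
    have hc := (commute_invJM_of_succ_lt hfar hbr hij hj).units_inv_right
    exact (hc.mul_right (ih (by omega))).mul_right hc

theorem commute_conjCopy_invJM (hfar : ∀ i j, i + 1 < j → Commute (r i : B) (r j))
    (hbr : ∀ i, i + 1 < n → (r i * r (i + 1) * r i : B) = r (i + 1) * r i * r (i + 1)) {x : B}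
    (hx : ∀ i, 0 < i → Commute x (r i))
    {j : ℕ} (hj : j ≤ n) {i : ℕ} (hij : i < j) : Commute (conjCopy r x j) (invJM r i) := by
  induction i with
  | zero => exact Commute.one_right _
  | succ i ih =>
    have hc := (commute_conjCopy_of_succ_lt hfar hbr hx hij hj).units_inv_right
    exact (hc.mul_right (ih (by omega))).mul_right hc

theorem conjCopy_permutation (hfar : ∀ i j, i + 1 < j → Commute (r i : B) (r j))
    (hbr : ∀ i, i + 1 < n → (r i * r (i + 1) * r i : B) = r (i + 1) * r i * r (i + 1)) {d l : B}
    (hd : ∀ i, 0 < i → Commute d (r i)) (hl : ∀ i, 0 < i → Commute l (r i))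
    (hbase : d * r 0 * l = r 0 * l * ↑(r 0)⁻¹ * d * ↑(r 0)⁻¹ + d) {j : ℕ} (hj : j < n) :
    conjCopy r d j * r j * conjCopy r l j =
      r j * conjCopy r l j * ↑(r j)⁻¹ * conjCopy r d j * ↑(r j)⁻¹ + conjCopy r d j := by
  induction j with
  | zero => exact hbase
  | succ j ih =>
    have hcopy : ∀ {x : B}, (∀ i, 0 < i → Commute x (r i)) →
        SemiconjBy ((r j * r (j + 1) : Bˣ) : B) (conjCopy r x j) (conjCopy r x (j + 1)) := by
      intro x hx
      rw [Units.val_mul]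
      exact (semiconjBy_conjCopy r x j).mul_left
        (commute_conjCopy_of_lt hfar hx (Nat.lt_succ_self j)).symm
    have hr : SemiconjBy ((r j * r (j + 1) : Bˣ) : B) (r j) (r (j + 1)) := by
      simp only [SemiconjBy, Units.val_mul, ← mul_assoc]
      exact hbr j hj
    have hr' := hr.units_inv_right
    have hD := hcopy hd
    have hL := hcopy hl
    have h := (hD.mul_right hr).mul_right hL
    rw [ih (by omega)] at h
    exact eq_of_semiconjBy_unit h
      (((((hr.mul_right hL).mul_right hr').mul_right hD).mul_right hr').add_right hD)

/-- The product `x_{j-1} ⋯ x₁ x₀` of the conjugation copies of `x`. -/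
def conjProdRev (r : ℕ → Bˣ) (x : B) : ℕ → B
  | 0 => 1
  | j + 1 => conjCopy r x j * conjProdRev r x j

theorem commute_conjProdRev_of_le (hfar : ∀ i j, i + 1 < j → Commute (r i : B) (r j)) {x : B}
    (hx : ∀ i, 0 < i → Commute x (r i)) {j i : ℕ} (hij : j ≤ i) :
    Commute (conjProdRev r x j) (r i) := by
  induction j with
  | zero => exact Commute.one_left _
  | succ j ih => exact (commute_conjCopy_of_lt hfar hx hij).mul_left (ih (by omega))

theorem conjProdRev_mul_conjCopy {K : Type*} [Field K] [Algebra K B]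
    (hfar : ∀ i j, i + 1 < j → Commute (r i : B) (r j))
    (hbr : ∀ i, i + 1 < n → (r i * r (i + 1) * r i : B) = r (i + 1) * r i * r (i + 1)) {d l : B}
    (hd : ∀ i, 0 < i → Commute d (r i)) (hl : ∀ i, 0 < i → Commute l (r i))
    (hbase : d * r 0 * l = r 0 * l * ↑(r 0)⁻¹ * d * ↑(r 0)⁻¹ + d) {t : K} (ht : t ≠ 0)
    (hhecke : ∀ i, i < n → (r i : B) = ↑(r i)⁻¹ + t • 1) {j : ℕ} (hj : j ≤ n) :
    conjProdRev r d j * conjCopy r l j =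
      conjCopy r l j * conjProdRev r d j * invJM r j +
        conjProdRev r d j * (t⁻¹ • (1 - invJM r j)) := by
  induction j with
  | zero => simp [conjProdRev, invJM]
  | succ j ih =>
    have hperm := conjCopy_permutation hfar hbr hd hl hbase (show j < n by omega)
    have hP := commute_conjProdRev_of_le hfar hd (le_refl j)
    have hP' := hP.units_inv_right
    have hcoef : invJM r j * ↑(r j)⁻¹ + (r j : B) * (t⁻¹ • (1 - invJM r j)) * ↑(r j)⁻¹ =
        t⁻¹ • (1 - ↑(r j)⁻¹ * invJM r j * ↑(r j)⁻¹) := by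
      have h1 : (r j : B) * invJM r j * ↑(r j)⁻¹ =
          ↑(r j)⁻¹ * invJM r j * ↑(r j)⁻¹ + t • (invJM r j * ↑(r j)⁻¹) := by
        nth_rw 1 [hhecke j (by omega)]
        simp [add_mul]
      have h2 : (r j : B) * (t⁻¹ • (1 - invJM r j)) * ↑(r j)⁻¹ =
          t⁻¹ • (1 - (r j : B) * invJM r j * ↑(r j)⁻¹) := by
        simp [mul_sub, sub_mul]
      rw [h2, h1, ← sub_sub, smul_sub _ _ (t • _), smul_smul, inv_mul_cancel₀ ht, one_smul]
      abel
    calc conjProdRev r d (j + 1) * conjCopy r l (j + 1)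
        = conjCopy r d j * (conjProdRev r d j * r j) * conjCopy r l j * ↑(r j)⁻¹ := by
          simp only [conjProdRev, conjCopy, mul_assoc]
      _ = conjCopy r d j * r j * (conjProdRev r d j * conjCopy r l j) * ↑(r j)⁻¹ := by
          rw [hP.eq]; simp only [mul_assoc]
      _ = (conjCopy r d j * r j * conjCopy r l j) * conjProdRev r d j * invJM r j * ↑(r j)⁻¹ +
          conjCopy r d j * (r j * conjProdRev r d j) * (t⁻¹ • (1 - invJM r j)) * ↑(r j)⁻¹ := by
          rw [ih (by omega)]; simp only [mul_add, add_mul, mul_assoc]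
      _ = r j * conjCopy r l j * ↑(r j)⁻¹ * conjCopy r d j * (↑(r j)⁻¹ * conjProdRev r d j) *
            invJM r j * ↑(r j)⁻¹ +
          conjCopy r d j * conjProdRev r d j *
            (invJM r j * ↑(r j)⁻¹ + r j * (t⁻¹ • (1 - invJM r j)) * ↑(r j)⁻¹) := by
          rw [hperm, ← hP.eq]; simp only [mul_add, add_mul, mul_assoc, add_assoc]
      _ = _ := by
          rw [hcoef, ← hP'.eq]; simp only [conjProdRev, conjCopy, invJM, mul_assoc]

end Abstract

/-! ### Embedding a block of sites -/

section Embedding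

variable {α : Type*} [Semiring α] {N m n p : ℕ}

/-- Operator on `n` sites acting as `X` on the sites in the image of `e`. -/
def siteEmb (e : Fin m → Fin n) (X : Matrix (Fin m → Fin N) (Fin m → Fin N) α) :
    Matrix (Fin n → Fin N) (Fin n → Fin N) α :=
  Matrix.of fun a b => if ∀ l, (∀ j, e j ≠ l) → a l = b l then X (a ∘ e) (b ∘ e) else 0

theorem siteEmb_add (e : Fin m → Fin n) (X Y : Matrix (Fin m → Fin N) (Fin m → Fin N) α) :
    siteEmb e (X + Y) = siteEmb e X + siteEmb e Y := by
  ext a b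
  simp only [siteEmb, Matrix.of_apply, Matrix.add_apply]
  split_ifs <;> simp

theorem siteEmb_mul {e : Fin m → Fin n} (he : Function.Injective e)
    (X Y : Matrix (Fin m → Fin N) (Fin m → Fin N) α) :
    siteEmb e (X * Y) = siteEmb e X * siteEmb e Y := by
  ext a b
  simp only [siteEmb, Matrix.of_apply, Matrix.mul_apply]
  split_ifs with hab
  · refine Finset.sum_of_injOn (fun c => Function.extend e c a) ?_ ?_ ?_ ?_
    · intro c _ c' _ h
      funext j
      have := congrFun h (e j)
      simpa [he.extend_apply] using this
    · intro c _
      simp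
    · intro c _ hc
      rw [if_neg, zero_mul]
      intro hac
      refine hc ⟨c ∘ e, by simp, ?_⟩
      funext l
      by_cases hl : ∃ j, e j = l
      · obtain ⟨j, rfl⟩ := hl
        simp [he.extend_apply]
      · simp only [Function.extend_apply' _ _ _ hl]
        exact hac l (by simpa using hl)
    · intro c _
      have h0 : ∀ l, (∀ j, e j ≠ l) → Function.extend e c a l = a l := fun l hl =>
        Function.extend_apply' _ _ _ (by simpa using hl)
      rw [if_pos (fun l hl => (h0 l hl).symm), if_pos (fun l hl => (h0 l hl).trans (hab l hl)),
        show Function.extend e c a ∘ e = c from funext fun j => he.extend_apply c a j]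
  · refine (Finset.sum_eq_zero fun c _ => ?_).symm
    by_cases hac : ∀ l, (∀ j, e j ≠ l) → a l = c l
    · rw [if_neg (c := ∀ l, (∀ j, e j ≠ l) → c l = b l), mul_zero]
      exact fun hcb => hab fun l hl => (hac l hl).trans (hcb l hl)
    · rw [if_neg hac, zero_mul]

theorem siteEmb_mul_apply_of_disjoint {e : Fin m → Fin n} {f : Fin p → Fin n}
    (hef : ∀ i j, e i ≠ f j)
    (X : Matrix (Fin m → Fin N) (Fin m → Fin N) α)
    (Y : Matrix (Fin p → Fin N) (Fin p → Fin N) α) (a b : Fin n → Fin N) :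
    (siteEmb e X * siteEmb f Y) a b =
      if ∀ l, (∀ j, e j ≠ l) → (∀ j, f j ≠ l) → a l = b l then
        X (a ∘ e) (b ∘ e) * Y (a ∘ f) (b ∘ f) else 0 := by
  classical
  simp only [siteEmb, Matrix.of_apply, Matrix.mul_apply]
  rw [Finset.sum_eq_single (fun l => if ∃ j, e j = l then b l else a l)]
  · have h1 : (fun l => if ∃ j, e j = l then b l else a l) ∘ e = b ∘ e := by
      funext j; simp
    have h2 : (fun l => if ∃ j, e j = l then b l else a l) ∘ f = a ∘ f := by
      funext j; simp [hef]
    rw [h1, h2, if_pos]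
    · by_cases hab : ∀ l, (∀ j, e j ≠ l) → (∀ j, f j ≠ l) → a l = b l
      · rw [if_pos hab, if_pos]
        intro l hl
        by_cases he : ∃ j, e j = l
        · simp [he]
        · simpa [he] using hab l (by simpa using he) hl
      · rw [if_neg hab, if_neg, mul_zero]
        intro h
        refine hab fun l hl hl' => ?_
        have := h l hl'
        simpa [hl] using this
    · intro l hl
      simp [hl]
  · intro c _ hc
    by_contra hne
    have hac := of_not_not fun h => hne (by rw [if_neg h, zero_mul])
    have hcb := of_not_not fun h => hne (by
      rw [if_neg (c := ∀ l, (∀ j, f j ≠ l) → c l = b l) h, mul_zero])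
    refine hc (funext fun l => ?_)
    by_cases he : ∃ j, e j = l
    · obtain ⟨j, rfl⟩ := he
      simpa using hcb (e j) fun i => (hef j i).symm
    · simpa [he] using (hac l (by simpa using he)).symm
  · simp

theorem siteEmb_commute_of_disjoint {e : Fin m → Fin n} {f : Fin p → Fin n}
    (hef : ∀ i j, e i ≠ f j)
    {X : Matrix (Fin m → Fin N) (Fin m → Fin N) α}
    {Y : Matrix (Fin p → Fin N) (Fin p → Fin N) α}
    (hXY : ∀ a b c d, Commute (X a b) (Y c d)) : Commute (siteEmb e X) (siteEmb f Y) := by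
  ext a b
  rw [siteEmb_mul_apply_of_disjoint hef,
    siteEmb_mul_apply_of_disjoint (fun i j => (hef j i).symm), (hXY _ _ _ _).eq]
  congr 1
  exact propext ⟨fun h l h1 h2 => h l h2 h1, fun h l h1 h2 => h l h2 h1⟩

/-- The block of `m` consecutive sites starting at `i`. -/
def siteBlock (i : ℕ) (h : i + m ≤ n) (j : Fin m) : Fin n := ⟨i + j, by omega⟩

theorem siteBlock_injective (i : ℕ) (h : i + m ≤ n) :
    Function.Injective (siteBlock i h) := by
  intro a b hab
  simp only [siteBlock, Fin.mk.injEq] at hab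
  ext
  omega

theorem siteEmb_matAt (i : ℕ) (h : i + m ≤ n) (X : Matrix (Fin N) (Fin N) α) {j : ℕ}
    (hj : j < m) : siteEmb (siteBlock i h) (matAt N m X j) = matAt N n X (i + j) := by
  ext a b
  have hij : i + j < n := by omega
  simp only [siteEmb, matAt, hj, hij, dif_pos, Matrix.of_apply, ← ite_and]
  refine if_congr ⟨?_, ?_⟩ rfl rfl
  · rintro ⟨h1, h2⟩ l hl
    by_cases hlm : i ≤ l ∧ (l : ℕ) < i + m
    · have := h2 ⟨l - i, by omega⟩ (by simp; omega)
      have hl' : siteBlock i h ⟨l - i, by omega⟩ = l := Fin.ext (by simp [siteBlock]; omega)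
      simpa [hl'] using this
    · refine h1 l fun j hj => hlm ?_
      rw [← hj]; simp [siteBlock]
  · intro h1
    refine ⟨fun l hl => h1 l fun hl' => hl ⟨j, hj⟩ (Fin.ext hl'.symm), fun l hl => h1 _ ?_⟩
    simp [siteBlock]; omega

theorem siteEmb_opAt (i : ℕ) (h : i + m ≤ n) (R : Matrix (Fin N × Fin N) (Fin N × Fin N) α)
    {j : ℕ} (hj : j + 1 < m) :
    siteEmb (siteBlock i h) (opAt N m R j) = opAt N n R (i + j) := by
  ext a b
  have hij : i + j + 1 < n := by omega
  simp only [siteEmb, opAt, hj, hij, dif_pos, Matrix.of_apply, ← ite_and]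
  refine if_congr ⟨?_, ?_⟩ rfl rfl
  · rintro ⟨h1, h2⟩ l hl hl1
    by_cases hlm : i ≤ l ∧ (l : ℕ) < i + m
    · have := h2 ⟨l - i, by omega⟩ (by simp; omega) (by simp; omega)
      have hl' : siteBlock i h ⟨l - i, by omega⟩ = l := Fin.ext (by simp [siteBlock]; omega)
      simpa [hl'] using this
    · refine h1 l fun j hj => hlm ?_
      rw [← hj]; simp [siteBlock]
  · intro h1
    refine ⟨fun l hl => h1 l (fun hl' => hl ⟨j, by omega⟩ (Fin.ext hl'.symm))
      fun hl' => hl ⟨j + 1, hj⟩ (Fin.ext hl'.symm), fun l hl hl1 => h1 _ ?_ ?_⟩ <;>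
    · simp [siteBlock]; omega

theorem matAt_mul (X Y : Matrix (Fin N) (Fin N) α) {i : ℕ} (h : i < n) :
    matAt N n (X * Y) i = matAt N n X i * matAt N n Y i := by
  have h1 : ∀ X : Matrix (Fin N) (Fin N) α,
      matAt N 1 X 0 = X.submatrix (Equiv.funUnique (Fin 1) (Fin N))
        (Equiv.funUnique (Fin 1) (Fin N)) := by
    intro X
    ext a b
    simp [matAt]
  have h2 : ∀ X : Matrix (Fin N) (Fin N) α,
      matAt N n X i = siteEmb (siteBlock i (show i + 1 ≤ n by omega)) (matAt N 1 X 0) :=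
    fun X => (siteEmb_matAt i _ X one_pos).symm
  rw [h2, h2, h2, ← siteEmb_mul (siteBlock_injective _ _), h1, h1, h1,
    Matrix.submatrix_mul_equiv]

theorem opAt_mul (X Y : Matrix (Fin N × Fin N) (Fin N × Fin N) α) {i : ℕ} (h : i + 1 < n) :
    opAt N n (X * Y) i = opAt N n X i * opAt N n Y i := by
  have h1 : ∀ X : Matrix (Fin N × Fin N) (Fin N × Fin N) α,
      opAt N 2 X 0 = X.submatrix (finTwoArrowEquiv (Fin N)) (finTwoArrowEquiv (Fin N)) := by
    intro X
    ext a b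
    simp [opAt]
  have h2 : ∀ X : Matrix (Fin N × Fin N) (Fin N × Fin N) α,
      opAt N n X i = siteEmb (siteBlock i (show i + 2 ≤ n by omega)) (opAt N 2 X 0) :=
    fun X => (siteEmb_opAt i _ X one_lt_two).symm
  rw [h2, h2, h2, ← siteEmb_mul (siteBlock_injective _ _), h1, h1, h1,
    Matrix.submatrix_mul_equiv]

theorem opAt_one (i : ℕ) : opAt N n (1 : Matrix _ _ α) i = 1 := by
  unfold opAt
  split_ifs with h
  · ext a b
    simp only [Matrix.of_apply, Matrix.one_apply, ← ite_and]
    refine if_congr ⟨?_, ?_⟩ rfl rfl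
    · rintro ⟨h1, h2⟩
      funext l
      simp only [Prod.mk.injEq] at h2
      by_cases hl : (l : ℕ) = i
      · have hl' : l = ⟨i, by omega⟩ := Fin.ext hl
        rw [hl']
        exact h2.1
      · by_cases hl1 : (l : ℕ) = i + 1
        · have hl' : l = ⟨i + 1, h⟩ := Fin.ext hl1
          rw [hl']
          exact h2.2
        · exact h1 l hl hl1
    · rintro rfl
      simp
  · rfl

theorem opAt_add (X Y : Matrix (Fin N × Fin N) (Fin N × Fin N) α) {i : ℕ} (h : i + 1 < n) :
    opAt N n (X + Y) i = opAt N n X i + opAt N n Y i := by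
  ext a b
  simp only [opAt, dif_pos h, Matrix.of_apply, Matrix.add_apply]
  split_ifs <;> simp

theorem opAt_smul {K : Type*} [SMulZeroClass K α] (c : K)
    (X : Matrix (Fin N × Fin N) (Fin N × Fin N) α) {i : ℕ} (h : i + 1 < n) :
    opAt N n (c • X) i = c • opAt N n X i := by
  ext a b
  simp only [opAt, dif_pos h, Matrix.of_apply, Matrix.smul_apply]
  split_ifs <;> simp

theorem opAt_mul_eq_one {X Y : Matrix (Fin N × Fin N) (Fin N × Fin N) α} (hXY : X * Y = 1)
    (i : ℕ) : opAt N n X i * opAt N n Y i = 1 := by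
  by_cases h : i + 1 < n
  · rw [← opAt_mul X Y h, hXY, opAt_one]
  · simp [opAt, h]

theorem normOrd_succ (R Rinv : Matrix (Fin N × Fin N) (Fin N × Fin N) α)
    (M D : Matrix (Fin N) (Fin N) α) (k : ℕ) :
    normOrd N n R Rinv M D (k + 1) =
      ovProd N n R Rinv M k * (ovCopy N n R Rinv M k * ovCopy N n R Rinv D k) *
        ovProdRev N n R Rinv D k *
        (((List.range k).map (fun s => JMup N n Rinv 0 s)).prod * JMup N n Rinv 0 k) := by
  simp [normOrd, ovProd, ovProdRev, List.range_succ, mul_assoc]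

end Embedding

section Numeric

variable {A : Type*} [Ring A] [Algebra ℂ A] {N n : ℕ}

theorem toA_mul {ι : Type*} [Fintype ι] (X Y : Matrix ι ι ℂ) :
    toA A (X * Y) = toA A X * toA A Y :=
  Matrix.map_mul

theorem toA_one {ι : Type*} [DecidableEq ι] : toA A (1 : Matrix ι ι ℂ) = 1 :=
  Matrix.map_one _ (map_zero _) (map_one _)

theorem opAt_toA (R : Matrix (Fin N × Fin N) (Fin N × Fin N) ℂ) (i : ℕ) :
    opAt N n (toA A R) i = toA A (opAt N n R i) := by
  unfold opAt
  split_ifs with h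
  · ext a b
    simp only [toA, Matrix.of_apply, Matrix.map_apply]
    split_ifs <;> simp
  · exact toA_one.symm

theorem commute_opAt_toA (R R' : Matrix (Fin N × Fin N) (Fin N × Fin N) ℂ) {i j : ℕ}
    (hij : i + 1 < j) : Commute (opAt N n (toA A R) i) (opAt N n (toA A R') j) := by
  by_cases hj : j + 1 < n
  · have h1 := siteEmb_opAt (N := N) i (show i + 2 ≤ n by omega) (toA A R) one_lt_two
    have h2 := siteEmb_opAt (N := N) j (show j + 2 ≤ n by omega) (toA A R') one_lt_two
    rw [add_zero] at h1 h2
    rw [← h1, ← h2]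
    refine siteEmb_commute_of_disjoint (fun a b h => ?_) fun a b c d => ?_
    · simp only [siteBlock, Fin.mk.injEq] at h
      omega
    · rw [opAt_toA]
      exact Algebra.commutes _ _
  · simp [opAt, hj]

theorem commute_matAt_opAt_toA (X : Matrix (Fin N) (Fin N) A)
    (R : Matrix (Fin N × Fin N) (Fin N × Fin N) ℂ) {i : ℕ} (hi : 0 < i) :
    Commute (matAt N n X 0) (opAt N n (toA A R) i) := by
  by_cases hn : i + 1 < n
  · have h1 := siteEmb_matAt (N := N) 0 (show 0 + 1 ≤ n by omega) X one_pos
    have h2 := siteEmb_opAt (N := N) i (show i + 2 ≤ n by omega) (toA A R) one_lt_two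
    rw [add_zero] at h1 h2
    rw [← h1, ← h2]
    refine siteEmb_commute_of_disjoint (fun a b h => ?_) fun a b c d => ?_
    · simp only [siteBlock, Fin.mk.injEq] at h
      omega
    · rw [opAt_toA]
      exact (Algebra.commutes _ _).symm
  · simp [opAt, hn]

theorem IsBraid.opAt_toA {R : Matrix (Fin N × Fin N) (Fin N × Fin N) ℂ} (h : IsBraid N R)
    {i : ℕ} (hi : i + 2 < n) :
    opAt N n (toA A R) i * opAt N n (toA A R) (i + 1) * opAt N n (toA A R) i =
      opAt N n (toA A R) (i + 1) * opAt N n (toA A R) i * opAt N n (toA A R) (i + 1) := by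
  have hb : opAt N 3 (toA A R) 0 * opAt N 3 (toA A R) 1 * opAt N 3 (toA A R) 0 =
      opAt N 3 (toA A R) 1 * opAt N 3 (toA A R) 0 * opAt N 3 (toA A R) 1 := by
    simp only [_root_.opAt_toA, ← toA_mul]
    exact congrArg _ h
  have h0 := siteEmb_opAt (N := N) i (show i + 3 ≤ n by omega) (toA A R)
    (show 0 + 1 < 3 by omega)
  have h1 := siteEmb_opAt (N := N) i (show i + 3 ≤ n by omega) (toA A R)
    (show 1 + 1 < 3 by omega)
  rw [add_zero] at h0
  have := congrArg (siteEmb (siteBlock i (show i + 3 ≤ n by omega))) hb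
  simpa only [siteEmb_mul (siteBlock_injective _ _), h0, h1] using this

theorem IsHecke.eq_inv_add {q : ℂ} (hq : q ≠ 0)
    {R Rinv : Matrix (Fin N × Fin N) (Fin N × Fin N) ℂ} (hR : R * Rinv = 1)
    (h : IsHecke N q R) : R = Rinv + (q - q⁻¹) • 1 := by
  have h1 := congrArg (· * Rinv) h
  simp only [sub_mul, mul_add, add_mul, smul_mul_assoc, mul_smul_comm, one_mul, mul_one,
    mul_assoc, hR, zero_mul, smul_sub, smul_smul, inv_mul_cancel₀ hq, one_smul] at h1
  rw [← sub_eq_zero, ← neg_eq_zero, ← h1]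
  module

theorem toA_add_smul_one (X : Matrix (Fin N × Fin N) (Fin N × Fin N) ℂ) (c : ℂ) :
    toA A (X + c • 1) = toA A X + c • 1 := by
  ext a b
  by_cases hab : a = b <;> simp [toA, hab, Algebra.algebraMap_eq_smul_one, add_smul]

/-- `R_{i+1}` on `V^{⊗n}` as a unit of `Mat_{N^n}(A)`. -/
def opUnit (A : Type*) [Ring A] [Algebra ℂ A] (n : ℕ)
    {R Rinv : Matrix (Fin N × Fin N) (Fin N × Fin N) ℂ}
    (h : R * Rinv = 1 ∧ Rinv * R = 1) (i : ℕ) :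
    (Matrix (Fin n → Fin N) (Fin n → Fin N) A)ˣ where
  val := opAt N n (toA A R) i
  inv := opAt N n (toA A Rinv) i
  val_inv := opAt_mul_eq_one (by rw [← toA_mul, h.1, toA_one]) i
  inv_val := opAt_mul_eq_one (by rw [← toA_mul, h.2, toA_one]) i

variable {R Rinv : Matrix (Fin N × Fin N) (Fin N × Fin N) ℂ}

theorem ovCopy_eq_conjCopy (h : R * Rinv = 1 ∧ Rinv * R = 1) (X : Matrix (Fin N) (Fin N) A)
    (j : ℕ) :
    ovCopy N n (toA A R) (toA A Rinv) X j = conjCopy (opUnit A n h) (matAt N n X 0) j := by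
  induction j with
  | zero => rfl
  | succ j ih => rw [ovCopy, ih]; rfl

theorem JMup_eq_invJM (h : R * Rinv = 1 ∧ Rinv * R = 1) (j : ℕ) :
    JMup N n (toA A Rinv) 0 j = invJM (opUnit A n h) j := by
  induction j with
  | zero => rfl
  | succ j ih => rw [JMup, ih, zero_add]; rfl

theorem ovProdRev_eq_conjProdRev (h : R * Rinv = 1 ∧ Rinv * R = 1)
    (X : Matrix (Fin N) (Fin N) A) (j : ℕ) :
    ovProdRev N n (toA A R) (toA A Rinv) X j =
      conjProdRev (opUnit A n h) (matAt N n X 0) j := by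
  induction j with
  | zero => rfl
  | succ j ih =>
    rw [conjProdRev, ← ih, ← ovCopy_eq_conjCopy]
    simp [ovProdRev, List.range_succ]

theorem PermRel.mul_matAt (h : R * Rinv = 1 ∧ Rinv * R = 1) {M D : Matrix (Fin N) (Fin N) A}
    (hD : RErel N (toA A Rinv) D) (hDM : PermRel N R Rinv M D) (hn : 2 ≤ n) :
    matAt N n D 0 * opAt N n (toA A R) 0 * matAt N n (M * D) 0 =
      opAt N n (toA A R) 0 * matAt N n (M * D) 0 * opAt N n (toA A Rinv) 0 * matAt N n D 0 *
        opAt N n (toA A Rinv) 0 + matAt N n D 0 := by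
  have hn' : 0 + 2 ≤ n := by omega
  have hm := fun X : Matrix (Fin N) (Fin N) A => siteEmb_matAt 0 hn' X two_pos
  have ho := fun X : Matrix (Fin N × Fin N) (Fin N × Fin N) A => siteEmb_opAt 0 hn' X one_lt_two
  have hD' := congrArg (siteEmb (siteBlock 0 hn')) hD
  have hP := congrArg (siteEmb (siteBlock 0 hn')) hDM
  simp only [siteEmb_mul (siteBlock_injective _ _), siteEmb_add, hm, ho, add_zero] at hD' hP
  rw [matAt_mul M D (show 0 < n by omega)]
  have h1 : opAt N n (toA A R) 0 * opAt N n (toA A Rinv) 0 = 1 := (opUnit A n h 0).mul_inv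
  generalize opAt N n (toA A R) 0 = r at *
  generalize opAt N n (toA A Rinv) 0 = s at *
  generalize matAt N n M 0 = m at *
  generalize matAt N n D 0 = d at *
  have h2 : d * r * m = r * m * s * d * s + 1 := by
    have := congrArg (· * s) hP
    simpa only [add_mul, mul_assoc, h1, mul_one] using this
  calc d * r * (m * d) = d * r * m * d := by simp only [mul_assoc]
    _ = r * m * (s * d * s * d) + d := by rw [h2]; simp only [add_mul, one_mul, mul_assoc]
    _ = _ := by rw [hD']; simp only [mul_assoc]

end Numeric

/-- **quantum Wick formula.** With `L̂ = MD`, for every `k ≥ 1` in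
`Mat_{N^{k+1}}(A)`: `:L̂_{⟨1→k⟩}: L̂_{⟨k+1⟩} = :L̂_{⟨1→(k+1)⟩}: + :L̂_{⟨1→k⟩}: (I − J_{k+1}⁻¹)/(q − q⁻¹)`,
where `:L̂_{⟨1→k⟩}: = M_{⟨1→k⟩} D_{⟨k→1⟩} ∏_{s=1}^{k} J_s⁻¹`. -/
theorem stmt16 {A : Type*} [Ring A] [Algebra ℂ A] (N : ℕ) (hN : 1 ≤ N) (q : ℂ)
    (hq : GenericQ q)
    (R Rinv : Matrix (Fin N × Fin N) (Fin N × Fin N) ℂ)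
    (hRinv : R * Rinv = 1 ∧ Rinv * R = 1)
    (hbraid : IsBraid N R) (hHecke : IsHecke N q R)
    (M D : Matrix (Fin N) (Fin N) A)
    (hM : RErel N (toA A R) M)
    (hD : RErel N (toA A Rinv) D)
    (hDM : PermRel N R Rinv M D)
    (k : ℕ) (hk : 1 ≤ k) :
    normOrd N (k + 1) (toA A R) (toA A Rinv) M D k *
        ovCopy N (k + 1) (toA A R) (toA A Rinv) (M * D) k =
      normOrd N (k + 1) (toA A R) (toA A Rinv) M D (k + 1) +
        normOrd N (k + 1) (toA A R) (toA A Rinv) M D k *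
          ((q - q⁻¹)⁻¹ •
            ((1 : Matrix (Fin (k + 1) → Fin N) (Fin (k + 1) → Fin N) A) -
              JMup N (k + 1) (toA A Rinv) 0 k)) := by
  set r := opUnit A (k + 1) hRinv with hr
  have hfar : ∀ i j, i + 1 < j → Commute (r i : Matrix (Fin (k + 1) → Fin N) (Fin (k + 1) → Fin N) A) (r j) :=
    fun i j hij => commute_opAt_toA R R hij
  have hbr : ∀ i, i + 1 < k →
      (r i * r (i + 1) * r i : Matrix (Fin (k + 1) → Fin N) (Fin (k + 1) → Fin N) A) = r (i + 1) * r i * r (i + 1) :=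
    fun i hi => hbraid.opAt_toA (by omega)
  have hcomm : ∀ X : Matrix (Fin N) (Fin N) A, ∀ i, 0 < i →
      Commute (matAt N (k + 1) X 0) (r i : Matrix (Fin (k + 1) → Fin N) (Fin (k + 1) → Fin N) A) :=
    fun X i hi => commute_matAt_opAt_toA X R hi
  have ht : q - q⁻¹ ≠ 0 := by
    intro h
    have h2 := hq.2.2.2 2 two_pos
    rw [sub_eq_zero] at h
    apply h2
    rw [sq]
    nth_rw 2 [h]
    exact mul_inv_cancel₀ hq.1
  have hhecke : ∀ i, i < k → (r i : Matrix (Fin (k + 1) → Fin N) (Fin (k + 1) → Fin N) A) = ↑(r i)⁻¹ + (q - q⁻¹) • 1 := by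
    intro i hi
    have hi' : i + 1 < k + 1 := by omega
    have h := congrArg (fun X => opAt N (k + 1) (toA A X) i) (hHecke.eq_inv_add hq.1 hRinv.1)
    simp only [toA_add_smul_one, opAt_add _ _ hi', opAt_smul _ _ hi', opAt_one] at h
    exact h
  have hmain := conjProdRev_mul_conjCopy hfar hbr (hcomm D) (hcomm (M * D))
    (hDM.mul_matAt hRinv hD (by omega)) ht hhecke le_rfl
  have hJ : ∀ x : Matrix (Fin (k + 1) → Fin N) (Fin (k + 1) → Fin N) A,
      (∀ i, i < k → Commute x (invJM r i)) →
      Commute x ((List.range k).map (fun s => JMup N (k + 1) (toA A Rinv) 0 s)).prod := by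
    intro x hx
    refine Commute.list_prod_right _ _ fun y hy => ?_
    obtain ⟨i, hi, rfl⟩ := List.mem_map.1 hy
    rw [JMup_eq_invJM hRinv]
    exact hx i (List.mem_range.1 hi)
  have hJL := hJ _ fun i hi => commute_conjCopy_invJM hfar hbr (hcomm (M * D)) le_rfl hi
  have hJJ := hJ _ fun i hi => commute_invJM_invJM hfar hbr le_rfl hi
  have hLMD : ovCopy N (k + 1) (toA A R) (toA A Rinv) M k *
      ovCopy N (k + 1) (toA A R) (toA A Rinv) D k = conjCopy r (matAt N (k + 1) (M * D) 0) k := by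
    rw [ovCopy_eq_conjCopy hRinv, ovCopy_eq_conjCopy hRinv, ← conjCopy_mul,
      matAt_mul _ _ (Nat.succ_pos k)]
  rw [normOrd_succ, hLMD, normOrd, ovCopy_eq_conjCopy hRinv, ovProdRev_eq_conjProdRev hRinv,
    JMup_eq_invJM hRinv, ← hr]
  generalize ((List.range k).map (fun s => JMup N (k + 1) (toA A Rinv) 0 s)).prod = P at *
  have hJJ' : Commute ((q - q⁻¹)⁻¹ • (1 - invJM r k)) P :=
    ((Commute.one_left P).sub_left hJJ).smul_left _
  rw [mul_assoc _ P, mul_assoc _ P, ← hJL.eq, ← hJJ.eq, ← hJJ'.eq]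
  simp only [mul_assoc]
  rw [← mul_add, ← mul_assoc _ _ P, hmain]
  simp only [add_mul, mul_assoc]
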